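/- Let α ∈ (0,1) and ε ∈ (0,1) satisfy (1−ε)³ ≥ 10α/(9+α). Let μ_1, …, μ_n ≥ 0 with ∑_{i=1}^n μ_i = n, let S ⊆ {1,…,n} be a set of servers such that μ_i ≤ (1−α)/10 for every i ∉ S, and suppose that for every i ∈ S an estimate μ̂_i satisfies (1−ε)·μ_i ≤ μ̂_i ≤ (1+ε)·μ_i. Define μ̄_i = μ̂_i/(1+ε) for i ∈ S and μ̄_i = 0 for i ∉ S. Then: (i) for every i ∈ S, ((1−ε)/(1+ε))·μ_i ≤ μ̄_i ≤ μ_i; and (ii) ∑_{i=1}^n μ̄_i ≥ α·n. -/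

import Mathlib

/-- **The deflated estimates underestimate the true rates but retain enough
total processing power.**
Let `α, ε ∈ (0,1)` with `(1-ε)³ ≥ 10α/(9+α)`.  Let `μ 1, …, μ n ≥ 0` sum to
`n`, let `S` be a set of servers such that `μ i ≤ (1-α)/10` for every
`i ∉ S`, and suppose each `i ∈ S` has an estimate `μ̂ i` with
`(1-ε)·μ i ≤ μ̂ i ≤ (1+ε)·μ i`.  Define `μ̄ i = μ̂ i/(1+ε)` for `i ∈ S` and
`μ̄ i = 0` otherwise.  Then (i) `((1-ε)/(1+ε))·μ i ≤ μ̄ i ≤ μ i` for every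
`i ∈ S`, and (ii) `∑ i, μ̄ i ≥ α·n`. -/
theorem deflated_estimates (α ε : ℝ) (hα0 : 0 < α) (hα1 : α < 1)
    (hε0 : 0 < ε) (hε1 : ε < 1)
    (hαε : 10 * α / (9 + α) ≤ (1 - ε) ^ 3)
    (n : ℕ) (μ : Fin n → ℝ) (hμnonneg : ∀ i, 0 ≤ μ i)
    (hμsum : ∑ i, μ i = (n : ℝ))
    (S : Finset (Fin n)) (hslow : ∀ i ∉ S, μ i ≤ (1 - α) / 10)
    (μhat : Fin n → ℝ)
    (hest : ∀ i ∈ S, (1 - ε) * μ i ≤ μhat i ∧ μhat i ≤ (1 + ε) * μ i)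
    (μbar : Fin n → ℝ)
    (hμbarS : ∀ i ∈ S, μbar i = μhat i / (1 + ε))
    (hμbar0 : ∀ i ∉ S, μbar i = 0) :
    (∀ i ∈ S, (1 - ε) / (1 + ε) * μ i ≤ μbar i ∧ μbar i ≤ μ i) ∧
    α * n ≤ ∑ i, μbar i := by
  have h1 : 0 < 1 + ε := by linarith
  have hc0 : 0 ≤ (1 - ε) / (1 + ε) := div_nonneg (by linarith) h1.le
  have hi : ∀ i ∈ S, (1 - ε) / (1 + ε) * μ i ≤ μbar i ∧ μbar i ≤ μ i := by
    intro i hi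
    obtain ⟨ha, hb⟩ := hest i hi
    rw [hμbarS i hi]
    constructor
    · rw [div_mul_eq_mul_div]
      exact div_le_div_of_nonneg_right ha h1.le
    · rw [div_le_iff₀ h1]
      linarith
  refine ⟨hi, ?_⟩
  have hc : (1 - ε) ^ 3 ≤ (1 - ε) / (1 + ε) := by
    rw [le_div_iff₀ h1]
    have h2 : (1 - ε) * (1 - ε ^ 2) ≤ 1 := by nlinarith [sq_nonneg ε]
    have h3 := mul_le_mul_of_nonneg_left h2 (show 0 ≤ 1 - ε by linarith)
    nlinarith [h3]
  have hα : α ≤ (1 - ε) / (1 + ε) * ((9 + α) / 10) := by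
    have h := (div_le_iff₀ (show 0 < 9 + α by linarith)).1 (hαε.trans hc)
    linarith
  have hsum : ∑ i, (1 - ε) / (1 + ε) * (μ i - (1 - α) / 10) ≤ ∑ i, μbar i := by
    apply Finset.sum_le_sum
    intro i _
    by_cases h : i ∈ S
    · refine le_trans (mul_le_mul_of_nonneg_left ?_ hc0) (hi i h).1
      linarith
    · rw [hμbar0 i h]
      exact mul_nonpos_of_nonneg_of_nonpos hc0 (by linarith [hslow i h])
  refine le_trans ?_ hsum
  rw [← Finset.mul_sum, Finset.sum_sub_distrib, hμsum]
  simp only [Finset.sum_const, Finset.card_univ, Fintype.card_fin, nsmul_eq_mul]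
  have h4 := mul_le_mul_of_nonneg_right hα (Nat.cast_nonneg (α := ℝ) n)
  refine h4.trans (le_of_eq ?_)
  ring
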